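/- arXiv:1711.05994 — 7 statements merged into one kernel-verified Lean document; each statement's English description precedes it below -/
import Mathlib

section
/- Let A = ⟨α, β, {A_a}⟩ be a WFA over a finite alphabet Σ such that f_A(x) ≥ 0 for all x ∈ Σ*, and let A = Σ_{a∈Σ} A_a with spectral radius ρ = ρ(A). Then: (1) if A is a minimal WFA and f_A ∈ ℓ¹(Σ) (i.e. Σ_{x∈Σ*} |f_A(x)| < ∞), then ρ < 1; and (2) if ρ < 1, then f_A ∈ ℓ¹(Σ). -/
open scoped ENNReal
open scoped Kronecker
open Matrix

noncomputable section

/-- A weighted finite automaton of dimension `n` over alphabet `S`,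
with initial weights, final weights and transition matrices. -/
structure WFA (S : Type*) (n : ℕ) where
  init : Fin n → ℝ
  final : Fin n → ℝ
  trans : S → Matrix (Fin n) (Fin n) ℝ

namespace WFA

variable {S : Type*} {n : ℕ}

/-- `A_x = A_{x₁} ⋯ A_{x_t}` (identity for the empty string). -/
def matOf (M : WFA S n) (x : List S) : Matrix (Fin n) (Fin n) ℝ :=
  (x.map M.trans).prod

/-- The function computed by the WFA: `f_A(x) = αᵀ A_x β`. -/
def f (M : WFA S n) (x : List S) : ℝ :=
  M.init ⬝ᵥ (M.matOf x).mulVec M.final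

/-- Row `p` of the forward matrix: `αᵀ A_p`. -/
def fwd (M : WFA S n) (x : List S) : Fin n → ℝ :=
  Matrix.vecMul M.init (M.matOf x)

/-- Row `s` of the backward matrix: `(A_s β)ᵀ`. -/
def bwd (M : WFA S n) (x : List S) : Fin n → ℝ :=
  (M.matOf x).mulVec M.final

/-- `M` is a minimal WFA: no WFA of strictly smaller dimension computes the same function. -/
def Min (M : WFA S n) : Prop :=
  ∀ m : ℕ, (∃ B : WFA S m, B.f = M.f) → n ≤ m

/-- The reachability Gramian `G_p = Pᵀ P` is well-defined: all its defining sums converge. -/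
def GpDefined (M : WFA S n) : Prop :=
  ∀ i j, Summable fun x : List S => M.fwd x i * M.fwd x j

/-- The observability Gramian `G_s = Sᵀ S` is well-defined: all its defining sums converge. -/
def GsDefined (M : WFA S n) : Prop :=
  ∀ i j, Summable fun x : List S => M.bwd x i * M.bwd x j

/-- The reachability Gramian `G_p = Pᵀ P`. -/
def Gp (M : WFA S n) : Matrix (Fin n) (Fin n) ℝ :=
  Matrix.of fun i j => ∑' x : List S, M.fwd x i * M.fwd x j

/-- The observability Gramian `G_s = Sᵀ S`. -/
def Gs (M : WFA S n) : Matrix (Fin n) (Fin n) ℝ :=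
  Matrix.of fun i j => ∑' x : List S, M.bwd x i * M.bwd x j

/-- Truncation of a WFA to its first `m` states. -/
def trunc (M : WFA S n) (m : ℕ) (h : m ≤ n) : WFA S m where
  init := fun i => M.init (Fin.castLE h i)
  final := fun i => M.final (Fin.castLE h i)
  trans := fun a => Matrix.of fun i j => M.trans a (Fin.castLE h i) (Fin.castLE h j)

end WFA

/-- A function `f : Σ* → ℝ` is rational if it is computed by some WFA. -/
def IsRational {S : Type*} (f : List S → ℝ) : Prop :=
  ∃ (n : ℕ) (M : WFA S n), M.f = f

/-- Spectral radius of a real square matrix: the largest modulus of its complex eigenvalues. -/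
def specRad {d : Type*} [Fintype d] [DecidableEq d] (M : Matrix d d ℝ) : ℝ≥0∞ :=
  spectralRadius ℂ (M.map (algebraMap ℝ ℂ))

/-- Induced ∞-norm of a matrix: maximum absolute row sum. -/
def normInfM {d e : Type*} [Fintype d] [Fintype e] (M : Matrix d e ℝ) : ℝ :=
  ⨆ i, ∑ j, |M i j|

/-- Induced 1-norm of a matrix: maximum absolute column sum. -/
def normOneM {d e : Type*} [Fintype d] [Fintype e] (M : Matrix d e ℝ) : ℝ :=
  ⨆ j, ∑ i, |M i j|

/-- The `p`-norm of a finite-dimensional real vector, `1 ≤ p ≤ ∞`. -/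
def vecPNorm {d : Type*} [Fintype d] (p : ℝ≥0∞) (v : d → ℝ) : ℝ :=
  if p = ⊤ then ⨆ i, |v i| else (∑ i, |v i| ^ p.toReal) ^ (1 / p.toReal)

/-- The induced matrix `p`-norm `‖M‖_p = sup_{‖v‖_p = 1} ‖Mv‖_p`. -/
def inducedPNorm {d : Type*} [Fintype d] (p : ℝ≥0∞) (M : Matrix d d ℝ) : ℝ :=
  sSup {r | ∃ v : d → ℝ, vecPNorm p v = 1 ∧ r = vecPNorm p (M.mulVec v)}

/-- The operator norm of the Hankel operator of `f` on `ℓ²`. -/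
def hankelOpNorm {S : Type*} (f : List S → ℝ) : ℝ :=
  sSup {r | ∃ g : List S → ℝ, (Summable fun y => g y ^ 2) ∧ (∑' y, g y ^ 2) ≤ 1 ∧
    (Summable fun x : List S => (∑' y : List S, f (x ++ y) * g y) ^ 2) ∧
    r = Real.sqrt (∑' x : List S, (∑' y : List S, f (x ++ y) * g y) ^ 2)}

end
attribute [local instance] Matrix.linftyOpNormedRing Matrix.linftyOpNormedAlgebra in
/-- In finite dimension, the powers of a matrix of spectral radius less than one are summable. -/
theorem Matrix.summable_pow_of_spectralRadius_lt_one {d : Type*} [Fintype d] [DecidableEq d]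
    {A : Matrix d d ℂ} (hA : spectralRadius ℂ A < 1) : Summable fun t : ℕ => A ^ t := by
  obtain ⟨r, hρr, hr⟩ := ENNReal.lt_iff_exists_nnreal_btwn.1 hA
  have hr : r < 1 := by exact_mod_cast hr
  have hev := (spectrum.pow_nnnorm_pow_one_div_tendsto_nhds_spectralRadius A).eventually
    (gt_mem_nhds hρr)
  refine Summable.of_norm_bounded_eventually_nat
    (g := fun t => (r : ℝ) ^ t) (summable_geometric_of_lt_one r.2 hr) ?_
  filter_upwards [hev, Filter.eventually_gt_atTop 0] with t ht ht0
  have ht0' : (0 : ℝ) < t := by exact_mod_cast ht0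
  have h := ENNReal.rpow_le_rpow ht.le ht0'.le
  rw [← ENNReal.rpow_mul, one_div_mul_cancel ht0'.ne', ENNReal.rpow_one,
    ENNReal.rpow_natCast] at h
  exact_mod_cast h

attribute [local instance] Matrix.linftyOpNormedRing Matrix.linftyOpNormedAlgebra in
/-- If the powers of a matrix tend to zero, its spectral radius is less than one. -/
theorem Matrix.spectralRadius_lt_one_of_tendsto_pow {d : Type*} [Fintype d] [DecidableEq d]
    {A : Matrix d d ℂ} (hA : Filter.Tendsto (fun t : ℕ => A ^ t) Filter.atTop (nhds 0)) :
    spectralRadius ℂ A < 1 := by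
  rcases isEmpty_or_nonempty d with hd | hd
  · simp [Subsingleton.elim A 0]
  obtain ⟨k, hk, hkρ⟩ := spectrum.exists_nnnorm_eq_spectralRadius A
  have hlim : Filter.Tendsto (fun t : ℕ => ‖A ^ t‖ * ‖(1 : Matrix d d ℂ)‖) Filter.atTop
      (nhds 0) := by
    simpa using hA.norm.mul_const ‖(1 : Matrix d d ℂ)‖
  obtain ⟨t, ht⟩ := (hlim.eventually (gt_mem_nhds zero_lt_one)).exists
  have hkt : ‖k ^ t‖ < 1 :=
    (spectrum.norm_le_norm_mul_of_mem (spectrum.pow_mem_pow A t hk)).trans_lt ht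
  rw [norm_pow] at hkt
  have hk1 : ‖k‖ < 1 := by
    by_contra! h
    exact hkt.not_ge (one_le_pow₀ h)
  rw [← hkρ]
  exact_mod_cast hk1

theorem Matrix.map_algebraMap_pow {d : Type*} [Fintype d] [DecidableEq d] (A : Matrix d d ℝ)
    (t : ℕ) : A.map (algebraMap ℝ ℂ) ^ t = (A ^ t).map (algebraMap ℝ ℂ) :=
  (map_pow (algebraMap ℝ ℂ).mapMatrix A t).symm

theorem summable_dotProduct_pow_mulVec {d : Type*} [Fintype d] [DecidableEq d]
    {A : Matrix d d ℝ} (hA : specRad A < 1) (u w : d → ℝ) :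
    Summable fun t : ℕ => u ⬝ᵥ (A ^ t) *ᵥ w := by
  let φ : Matrix d d ℂ →+ ℝ :=
    { toFun := fun B => u ⬝ᵥ (B.map Complex.re) *ᵥ w
      map_zero' := by simp
      map_add' := fun B C => by
        rw [Matrix.map_add _ Complex.add_re, Matrix.add_mulVec, dotProduct_add] }
  have hφ : Continuous φ :=
    continuous_const.dotProduct
      ((continuous_id.matrix_map Complex.continuous_re).matrix_mulVec continuous_const)
  refine ((Matrix.summable_pow_of_spectralRadius_lt_one hA).map φ hφ).congr fun t => ?_
  have hre : ((A ^ t).map (algebraMap ℝ ℂ)).map Complex.re = A ^ t := by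
    ext i j
    simp
  change u ⬝ᵥ ((A.map (algebraMap ℝ ℂ) ^ t).map Complex.re) *ᵥ w = u ⬝ᵥ (A ^ t) *ᵥ w
  rw [Matrix.map_algebraMap_pow, hre]

theorem specRad_lt_one_of_tendsto {d : Type*} [Fintype d] [DecidableEq d] {A : Matrix d d ℝ}
    (hA : ∀ u w : d → ℝ,
      Filter.Tendsto (fun t : ℕ => u ⬝ᵥ (A ^ t) *ᵥ w) Filter.atTop (nhds 0)) :
    specRad A < 1 := by
  refine Matrix.spectralRadius_lt_one_of_tendsto_pow ?_
  refine tendsto_pi_nhds.2 fun i => tendsto_pi_nhds.2 fun j => ?_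
  have h := (Complex.continuous_ofReal.tendsto 0).comp (hA (Pi.single i 1) (Pi.single j 1))
  rw [Complex.ofReal_zero] at h
  refine h.congr fun t => ?_
  rw [Matrix.map_algebraMap_pow]
  simp

theorem Summable.sum_ofFn {S : Type*} [Fintype S] {g : List S → ℝ} (hg : Summable g) :
    Summable fun t : ℕ => ∑ v : Fin t → S, g (List.ofFn v) := by
  have h := ((List.equivSigmaTuple (α := S)).symm.summable_iff.2 hg).sigma
  refine h.congr fun t => ?_
  rw [tsum_fintype]
  rfl

theorem summable_of_summable_sum_ofFn {S : Type*} [Fintype S] {g : List S → ℝ}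
    (h0 : ∀ x, 0 ≤ g x) (hg : Summable fun t : ℕ => ∑ v : Fin t → S, g (List.ofFn v)) :
    Summable g := by
  rw [← (List.equivSigmaTuple (α := S)).symm.summable_iff]
  refine (summable_sigma_of_nonneg fun _ => h0 _).2 ⟨fun _ => .of_finite, hg.congr fun t => ?_⟩
  rw [tsum_fintype]
  rfl

namespace WFA

variable {S : Type*} {n m : ℕ}

theorem matOf_cons (M : WFA S n) (a : S) (x : List S) :
    M.matOf (a :: x) = M.trans a * M.matOf x := by
  simp [matOf]

theorem matOf_append (M : WFA S n) (x y : List S) :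
    M.matOf (x ++ y) = M.matOf x * M.matOf y := by
  simp [matOf]

theorem sum_matOf_ofFn [Fintype S] (M : WFA S n) (t : ℕ) :
    ∑ v : Fin t → S, M.matOf (List.ofFn v) = (∑ a : S, M.trans a) ^ t := by
  induction t with
  | zero => simp [matOf]
  | succ t ih =>
    rw [← (Fin.consEquiv fun _ => S).sum_comp, Fintype.sum_prod_type, pow_succ', ← ih,
      Finset.sum_mul_sum]
    refine Finset.sum_congr rfl fun a _ => Finset.sum_congr rfl fun v _ => ?_
    simp [Fin.consEquiv, matOf_cons]

theorem f_append_append (M : WFA S n) (p x s : List S) :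
    M.f (p ++ x ++ s) = M.fwd p ⬝ᵥ M.matOf x *ᵥ M.bwd s := by
  simp only [f, fwd, bwd, matOf_append, Matrix.dotProduct_mulVec, Matrix.vecMul_vecMul,
    Matrix.mul_assoc]

theorem sum_f_append_append [Fintype S] (M : WFA S n) (p s : List S) (t : ℕ) :
    ∑ v : Fin t → S, M.f (p ++ List.ofFn v ++ s) =
      M.fwd p ⬝ᵥ ((∑ a : S, M.trans a) ^ t) *ᵥ M.bwd s := by
  simp only [f_append_append, ← sum_matOf_ofFn, Matrix.sum_mulVec, dotProduct_sum]

theorem f_eq_of_intertwine (M : WFA S n) (B : WFA S m) (P : Matrix (Fin m) (Fin n) ℝ)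
    (hi : B.init ᵥ* P = M.init) (hf : P *ᵥ M.final = B.final)
    (ht : ∀ a, B.trans a * P = P * M.trans a) : B.f = M.f := by
  have h : ∀ x, B.matOf x * P = P * M.matOf x := by
    intro x
    induction x with
    | nil => simp [matOf]
    | cons a x ih =>
      rw [matOf_cons, matOf_cons, Matrix.mul_assoc, ih, ← Matrix.mul_assoc, ht, Matrix.mul_assoc]
  funext x
  rw [f, f, ← hf, ← hi, Matrix.mulVec_mulVec, h, ← Matrix.mulVec_mulVec,
    Matrix.dotProduct_mulVec B.init]

theorem fwd_append_singleton (M : WFA S n) (x : List S) (a : S) :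
    M.fwd (x ++ [a]) = M.fwd x ᵥ* M.trans a := by
  simp [fwd, matOf]

/-- The forward vectors of a minimal WFA span the whole space. -/
theorem Min.span_fwd {M : WFA S n} (hM : M.Min) :
    Submodule.span ℝ (Set.range M.fwd) = ⊤ := by
  set W := Submodule.span ℝ (Set.range M.fwd) with hW
  by_contra hne
  have hlt : Module.finrank ℝ W < n := by
    simpa using Submodule.finrank_lt hne
  have hinv : ∀ w ∈ W, ∀ a, w ᵥ* M.trans a ∈ W := by
    intro w hw a
    refine Submodule.span_induction (p := fun w _ => w ᵥ* M.trans a ∈ W) ?_ ?_ ?_ ?_ hw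
    · rintro _ ⟨x, rfl⟩
      rw [← fwd_append_singleton]
      exact Submodule.subset_span ⟨_, rfl⟩
    · simp
    · intro u v _ _ hu hv
      rw [Matrix.add_vecMul]
      exact add_mem hu hv
    · intro c u _ hu
      rw [Matrix.smul_vecMul]
      exact Submodule.smul_mem _ _ hu
  let b := Module.finBasis ℝ W
  let P : Matrix (Fin (Module.finrank ℝ W)) (Fin n) ℝ := Matrix.of fun i => (b i : Fin n → ℝ)
  have hP : ∀ w ∈ W, ∃ c, c ᵥ* P = w := by
    intro w hw
    refine ⟨b.repr ⟨w, hw⟩, ?_⟩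
    have h := congrArg Subtype.val (b.sum_repr ⟨w, hw⟩)
    rw [Submodule.coe_sum] at h
    rw [Matrix.vecMul_eq_sum]
    exact h
  have hinit : M.init ∈ W := Submodule.subset_span ⟨[], by simp [fwd, matOf]⟩
  obtain ⟨c, hc⟩ := hP _ hinit
  choose T hT using fun a i => hP _ (hinv _ (b i).2 a)
  refine hlt.not_ge (hM _ ⟨⟨c, P *ᵥ M.final, fun a => Matrix.of (T a)⟩, ?_⟩)
  refine f_eq_of_intertwine M _ P hc rfl fun a => ?_
  ext i j
  exact congrFun (hT a i) j

/-- The reversal of a WFA. -/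
def reverse (M : WFA S n) : WFA S n where
  init := M.final
  final := M.init
  trans a := (M.trans a)ᵀ

theorem matOf_reverse (M : WFA S n) (x : List S) :
    M.reverse.matOf x = (M.matOf x.reverse)ᵀ := by
  induction x with
  | nil => simp [matOf]
  | cons a x ih =>
    rw [matOf_cons, ih, List.reverse_cons, matOf_append, Matrix.transpose_mul]
    simp [matOf, reverse]

theorem fwd_reverse (M : WFA S n) (x : List S) : M.reverse.fwd x = M.bwd x.reverse := by
  rw [fwd, matOf_reverse, Matrix.vecMul_transpose]
  rfl

theorem f_reverse (M : WFA S n) (x : List S) : M.reverse.f x = M.f x.reverse := by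
  rw [f, f, matOf_reverse, Matrix.mulVec_transpose, dotProduct_comm,
    ← Matrix.dotProduct_mulVec]
  rfl

theorem Min.reverse {M : WFA S n} (hM : M.Min) : M.reverse.Min := by
  rintro k ⟨B, hB⟩
  refine hM k ⟨B.reverse, ?_⟩
  funext x
  rw [f_reverse, hB, f_reverse, List.reverse_reverse]

/-- The backward vectors of a minimal WFA span the whole space. -/
theorem Min.span_bwd {M : WFA S n} (hM : M.Min) :
    Submodule.span ℝ (Set.range M.bwd) = ⊤ := by
  rw [← hM.reverse.span_fwd]
  congr 1
  rw [← List.reverse_surjective.range_comp M.bwd]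
  exact congrArg Set.range (funext fun x => (M.fwd_reverse x).symm)

theorem Min.tendsto_dotProduct_pow_mulVec [Fintype S] {M : WFA S n} (hM : M.Min)
    (hf : Summable M.f) (u w : Fin n → ℝ) :
    Filter.Tendsto (fun t : ℕ => u ⬝ᵥ ((∑ a : S, M.trans a) ^ t) *ᵥ w)
      Filter.atTop (nhds 0) := by
  have hu : u ∈ Submodule.span ℝ (Set.range M.fwd) := hM.span_fwd ▸ Submodule.mem_top
  have hw : w ∈ Submodule.span ℝ (Set.range M.bwd) := hM.span_bwd ▸ Submodule.mem_top
  induction hu, hw using Submodule.span_induction₂ with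
  | mem_mem u w hu hw =>
    obtain ⟨p, rfl⟩ := hu
    obtain ⟨s, rfl⟩ := hw
    have hinj : Function.Injective fun x : List S => p ++ x ++ s := fun x y h => by
      simpa using h
    exact ((hf.comp_injective hinj).sum_ofFn.congr
      fun t => M.sum_f_append_append p s t).tendsto_atTop_zero
  | zero_left => simp
  | zero_right => simp
  | add_left u v w _ _ _ hu hv => simpa [add_dotProduct] using hu.add hv
  | add_right u v w _ _ _ hu hv => simpa [Matrix.mulVec_add] using hu.add hv
  | smul_left c u w _ _ h => simpa using h.const_mul c
  | smul_right c u w _ _ h => simpa [Matrix.mulVec_smul] using h.const_mul c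

end WFA

/-- for a WFA with non-negative function, (1) minimal & `f_A ∈ ℓ¹` implies
`ρ(∑_a A_a) < 1`, and (2) `ρ(∑_a A_a) < 1` implies `f_A ∈ ℓ¹`. -/
theorem nonneg_wfa_ell_one_iff_spectral_radius {S : Type*} [Fintype S] {n : ℕ} (M : WFA S n)
    (hpos : ∀ x : List S, 0 ≤ M.f x) :
    ((M.Min ∧ Summable fun x : List S => |M.f x|) → specRad (∑ a : S, M.trans a) < 1) ∧
    (specRad (∑ a : S, M.trans a) < 1 → Summable fun x : List S => |M.f x|) := by
  simp only [abs_of_nonneg (hpos _)]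
  refine ⟨fun ⟨hM, hf⟩ => specRad_lt_one_of_tendsto (hM.tendsto_dotProduct_pow_mulVec hf),
    fun hρ => summable_of_summable_sum_ofFn hpos ?_⟩
  refine (summable_dotProduct_pow_mulVec hρ M.init M.final).congr fun t => ?_
  simpa [WFA.fwd, WFA.bwd, WFA.matOf] using (M.sum_f_append_append [] [] t).symm
end

section
/- Let f : Σ* → ℝ be a rational function. The Hankel operator H_f is bounded on ℓ²(Σ) if and only if f ∈ ℓ²(Σ). Precisely: there exists a constant C such that for every g ∈ ℓ²(Σ) the sums (H_f g)(x) = Σ_{y∈Σ*} f(xy)g(y) converge absolutely for every x and Σ_{x∈Σ*} (H_f g)(x)² ≤ C² Σ_{y∈Σ*} g(y)², if and only if Σ_{x∈Σ*} f(x)² < ∞. -/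
open scoped ENNReal
open scoped Kronecker
open Matrix

/-- The subspace of square-summable functions inside all real functions on `X`. -/
def squareSummable (X : Type*) : Submodule ℝ (X → ℝ) where
  carrier := {g | Summable fun x => g x ^ 2}
  zero_mem' := by simp
  add_mem' := by
    intro a b ha hb
    refine Summable.of_nonneg_of_le (fun x => sq_nonneg _) (fun x => ?_)
      ((ha.add hb).mul_left 2)
    simp only [Pi.add_apply]
    nlinarith [sq_nonneg (a x - b x)]
  smul_mem' := by
    intro c a ha
    simpa [mul_pow] using Summable.mul_left (c ^ 2) ha

theorem summable_mul_of_sq {X : Type*} {a b : X → ℝ} (ha : Summable fun x => a x ^ 2)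
    (hb : Summable fun x => b x ^ 2) : Summable fun x => |a x * b x| := by
  refine Summable.of_nonneg_of_le (fun x => abs_nonneg _) (fun x => ?_) (ha.add hb)
  rw [abs_mul]
  nlinarith [sq_nonneg (|a x| - |b x|), sq_abs (a x), sq_abs (b x), sq_nonneg (a x),
    sq_nonneg (b x)]

/-- Cauchy–Schwarz for infinite sums. -/
theorem tsum_mul_sq_le_tsum_sq_mul_tsum_sq {X : Type*} {a b : X → ℝ}
    (ha : Summable fun x => a x ^ 2) (hb : Summable fun x => b x ^ 2) :
    (∑' x, a x * b x) ^ 2 ≤ (∑' x, a x ^ 2) * ∑' x, b x ^ 2 :=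
  le_of_tendsto_of_tendsto' ((summable_mul_of_sq ha hb).of_abs.hasSum.pow 2)
    (Filter.Tendsto.mul ha.hasSum hb.hasSum) fun s => Finset.sum_mul_sq_le_sq_mul_sq s a b

/-- If all columns of a finite-rank kernel lie in a subspace `L`, the left factors of a
rank factorization may be chosen in `L`. -/
theorem exists_left_factors_mem {X Y ι : Type*} [Fintype ι] (L : Submodule ℝ (X → ℝ))
    (h : X → Y → ℝ) (a : ι → X → ℝ) (b : ι → Y → ℝ) (hab : ∀ x y, h x y = ∑ i, a i x * b i y)
    (hL : ∀ y, (fun x => h x y) ∈ L) :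
    ∃ u : ι → X → ℝ, (∀ i, u i ∈ L) ∧ ∀ x y, h x y = ∑ i, u i x * b i y := by
  obtain ⟨P, hP⟩ := L.subtype.exists_leftInverse_of_injective (by simp)
  refine ⟨fun i => P (a i), fun i => (P (a i)).2, fun x y => ?_⟩
  have hcol : (fun x => h x y) = ∑ i, b i y • a i := by
    ext x
    simp [hab, mul_comm]
  have hfix : P (fun x => h x y) = ⟨fun x => h x y, hL y⟩ :=
    LinearMap.congr_fun hP ⟨fun x => h x y, hL y⟩
  have hx : (P (fun x => h x y) : X → ℝ) x = h x y := by rw [hfix]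
  rw [hcol, map_sum] at hx
  simpa [hab, mul_comm] using hx.symm

/-- A kernel of finite rank with square-summable rows and columns is dominated, after
squaring, by a product of summable functions. -/
theorem exists_summable_sq_le_mul {X Y ι : Type*} [Fintype ι]
    (h : X → Y → ℝ) (a : ι → X → ℝ) (b : ι → Y → ℝ) (hab : ∀ x y, h x y = ∑ i, a i x * b i y)
    (hcol : ∀ y, Summable fun x => h x y ^ 2) (hrow : ∀ x, Summable fun y => h x y ^ 2) :
    ∃ (U : X → ℝ) (V : Y → ℝ), Summable U ∧ Summable V ∧ (∀ x, 0 ≤ U x) ∧ (∀ y, 0 ≤ V y) ∧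
      ∀ x y, h x y ^ 2 ≤ U x * V y := by
  obtain ⟨u, hu, hub⟩ := exists_left_factors_mem (squareSummable X) h a b hab hcol
  obtain ⟨v, hv, huv⟩ := exists_left_factors_mem (squareSummable Y) (fun y x => h x y) b u
    (fun y x => by simp [hub, mul_comm]) hrow
  refine ⟨fun x => ∑ i, u i x ^ 2, fun y => ∑ i, v i y ^ 2, summable_sum fun i _ => hu i,
    summable_sum fun i _ => hv i, fun x => Finset.sum_nonneg fun i _ => sq_nonneg _,
    fun y => Finset.sum_nonneg fun i _ => sq_nonneg _, fun x y => ?_⟩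
  rw [huv y x, mul_comm (∑ i, u i x ^ 2)]
  exact Finset.sum_mul_sq_le_sq_mul_sq _ _ _

theorem WFA.f_append {S : Type*} {n : ℕ} (M : WFA S n) (x y : List S) :
    M.f (x ++ y) = ∑ i, M.fwd x i * M.bwd y i := by
  change _ = M.fwd x ⬝ᵥ M.bwd y
  simp [WFA.f, WFA.fwd, WFA.bwd, WFA.matOf, ← Matrix.mulVec_mulVec, Matrix.dotProduct_mulVec]

/-- for rational `f`, the Hankel operator `H_f` is bounded on `ℓ²` iff `f ∈ ℓ²`. -/
theorem hankel_bounded_iff_ell_two {S : Type*} [Fintype S] (f : List S → ℝ)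
    (hf : IsRational f) :
    (∃ C : ℝ, ∀ g : List S → ℝ, (Summable fun y => g y ^ 2) →
      (∀ x : List S, Summable fun y : List S => |f (x ++ y) * g y|) ∧
      (Summable fun x : List S => (∑' y : List S, f (x ++ y) * g y) ^ 2) ∧
      (∑' x : List S, (∑' y : List S, f (x ++ y) * g y) ^ 2) ≤ C ^ 2 * ∑' y, g y ^ 2)
    ↔ Summable fun x : List S => f x ^ 2 := by
  classical
  constructor
  · rintro ⟨C, hC⟩
    let δ : List S → ℝ := Pi.single [] 1
    have hδ : ∀ y, y ≠ [] → δ y = 0 := fun y hy => Pi.single_eq_of_ne hy 1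
    have hδsum : Summable fun y => δ y ^ 2 :=
      summable_of_ne_finset_zero (s := {[]}) fun y hy => by
        simp [hδ y (by simpa using hy)]
    have hval : ∀ x, ∑' y, f (x ++ y) * δ y = f x := fun x => by
      rw [tsum_eq_single [] fun y hy => by simp [hδ y hy]]
      simp [δ]
    simpa only [hval] using (hC δ hδsum).2.1
  · intro hsum
    obtain ⟨n, M, rfl⟩ := hf
    have hrow : ∀ x, Summable fun y => M.f (x ++ y) ^ 2 := fun x =>
      hsum.comp_injective (List.append_right_injective x)
    have hcol : ∀ y, Summable fun x => M.f (x ++ y) ^ 2 := fun y =>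
      hsum.comp_injective (List.append_left_injective y)
    obtain ⟨U, V, hU, hV, hU0, hV0, hle⟩ := exists_summable_sq_le_mul
      (fun x y => M.f (x ++ y)) (fun i x => M.fwd x i) (fun i y => M.bwd y i)
      M.f_append hcol hrow
    refine ⟨√((∑' x, U x) * ∑' y, V y), fun g hg => ?_⟩
    rw [Real.sq_sqrt (mul_nonneg (tsum_nonneg hU0) (tsum_nonneg hV0))]
    have hbound : ∀ x, (∑' y, M.f (x ++ y) * g y) ^ 2 ≤
        U x * ((∑' y, V y) * ∑' y, g y ^ 2) := fun x => by
      refine (tsum_mul_sq_le_tsum_sq_mul_tsum_sq (hrow x) hg).trans ?_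
      have hx := (hrow x).tsum_le_tsum (hle x) (hV.mul_left _)
      rw [tsum_mul_left] at hx
      rw [← mul_assoc]
      exact mul_le_mul_of_nonneg_right hx (tsum_nonneg fun y => sq_nonneg _)
    have hUs := hU.mul_right ((∑' y, V y) * ∑' y, g y ^ 2)
    have hHs := Summable.of_nonneg_of_le (fun x => sq_nonneg _) hbound hUs
    refine ⟨fun x => summable_mul_of_sq (hrow x) hg, hHs, ?_⟩
    rw [mul_assoc, ← tsum_mul_right]
    exact hHs.tsum_le_tsum hbound hUs
end

section
/- Let f : Σ* → ℝ be a rational function of rank n and suppose H_f = P Sᵀ is a rank factorization, i.e. P, S ∈ ℝ^{Σ*×n} have rank n and H_f(p,s) = Σ_{i=1}^n P(p,i)S(s,i) for all p, s ∈ Σ*. Then there exists a minimal WFA A = ⟨α, β, {A_a}⟩ realizing f whose forward and backward matrices are exactly P and S: P(p,:) = αᵀA_p and S(s,:) = (A_s β)ᵀ for all p, s ∈ Σ*. -/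
open scoped ENNReal
open scoped Kronecker
open Matrix

/-- Linearly independent columns: only the zero vector is orthogonal to every row. -/
theorem eq_zero_of_forall_dotProduct_row_eq_zero {X : Type*} {n : ℕ} {P : X → Fin n → ℝ}
    (hP : LinearIndependent ℝ fun (i : Fin n) (x : X) => P x i)
    {v : Fin n → ℝ} (hv : ∀ x, v ⬝ᵥ P x = 0) : v = 0 := by
  refine funext (Fintype.linearIndependent_iff.mp hP v (funext fun x => ?_))
  simpa [dotProduct] using hv x

/-- Linearly independent columns: the rows span the whole space. -/
theorem span_range_rows_eq_top {X : Type*} {n : ℕ} {P : X → Fin n → ℝ}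
    (hP : LinearIndependent ℝ fun (i : Fin n) (x : X) => P x i) :
    Submodule.span ℝ (Set.range P) = ⊤ := by
  by_contra h
  obtain ⟨φ, hφ, hle⟩ := Submodule.exists_le_ker_of_lt_top _ (lt_top_iff_ne_top.mpr h)
  have hφ_apply (w : Fin n → ℝ) : φ w = (fun i => φ (Pi.single i 1)) ⬝ᵥ w := by
    rw [LinearMap.pi_apply_eq_sum_univ φ w]
    simp only [dotProduct, smul_eq_mul, mul_comm]
    congr! 4
    simp [Pi.single_apply, eq_comm]
  have hzero : (fun i => φ (Pi.single i 1)) = 0 :=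
    eq_zero_of_forall_dotProduct_row_eq_zero hP fun x => by
      rw [← hφ_apply]
      exact hle (Submodule.subset_span ⟨x, rfl⟩)
  refine hφ (LinearMap.ext fun w => ?_)
  rw [hφ_apply, hzero, zero_dotProduct, LinearMap.zero_apply]

/-- If an operation on right factors is adjoint to one on left factors, and the left factors have
linearly independent columns, then the operation is multiplication by a matrix. -/
theorem exists_mulVec_eq_of_dotProduct_eq {X Y : Type*} {n : ℕ}
    {P P' : X → Fin n → ℝ} {Q Q' : Y → Fin n → ℝ}
    (hP : LinearIndependent ℝ fun (i : Fin n) (x : X) => P x i)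
    (h : ∀ x y, P' x ⬝ᵥ Q y = P x ⬝ᵥ Q' y) :
    ∃ A : Matrix (Fin n) (Fin n) ℝ, ∀ y, A *ᵥ Q y = Q' y := by
  have hspan (i : Fin n) : ∃ c : X →₀ ℝ, (c.sum fun x r => r • P x) = Pi.single i 1 :=
    Finsupp.mem_span_range_iff_exists_finsupp.mp (by simp [span_range_rows_eq_top hP])
  choose c hc using hspan
  refine ⟨Matrix.of fun i => (c i).sum fun x r => r • P' x, fun y => funext fun i => ?_⟩
  calc ((c i).sum fun x r => r • P' x) ⬝ᵥ Q y
      = ((c i).sum fun x r => r • P x) ⬝ᵥ Q' y := by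
        simp only [Finsupp.sum, sum_dotProduct, smul_dotProduct, h]
    _ = Q' y i := by rw [hc, single_one_dotProduct]

/-- every rank factorization `H_f = P Sᵀ` of the Hankel matrix of a rational
function of rank `n` is the forward--backward factorization of some minimal WFA for `f`. -/
theorem rank_factorization_is_forward_backward {S : Type*} [Fintype S] {n : ℕ}
    (f : List S → ℝ)
    (hrat : ∃ B : WFA S n, B.f = f)
    (hrank : ∀ m : ℕ, (∃ B : WFA S m, B.f = f) → n ≤ m)
    (P Q : List S → Fin n → ℝ)
    (hP : LinearIndependent ℝ fun i : Fin n => fun x : List S => P x i)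
    (hQ : LinearIndependent ℝ fun i : Fin n => fun x : List S => Q x i)
    (hfact : ∀ p s : List S, f (p ++ s) = ∑ i : Fin n, P p i * Q s i) :
    ∃ M : WFA S n, M.f = f ∧ M.Min ∧ (∀ p, M.fwd p = P p) ∧ (∀ s, M.bwd s = Q s) := by
  have hshift (a : S) (p s : List S) : P (p ++ [a]) ⬝ᵥ Q s = P p ⬝ᵥ Q (a :: s) := by
    simp only [dotProduct, ← hfact, List.append_assoc, List.singleton_append]
  choose A hA using fun a => exists_mulVec_eq_of_dotProduct_eq hP (hshift a)
  have hA' (a : S) (p : List S) : P p ᵥ* A a = P (p ++ [a]) := by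
    refine sub_eq_zero.mp (eq_zero_of_forall_dotProduct_row_eq_zero hQ fun s => ?_)
    rw [sub_dotProduct, ← dotProduct_mulVec, hA, hshift, sub_self]
  let M : WFA S n := ⟨P [], Q [], A⟩
  have hfwd (p : List S) : M.fwd p = P p := by
    induction p using List.reverseRecOn with
    | nil => simp [WFA.fwd, WFA.matOf, M]
    | append_singleton p a ih =>
      rw [← hA', ← ih]
      simp [WFA.fwd, WFA.matOf, M, vecMul_vecMul]
  have hbwd (s : List S) : M.bwd s = Q s := by
    induction s with
    | nil => simp [WFA.bwd, WFA.matOf, M]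
    | cons a s ih =>
      rw [← hA, ← ih]
      simp [WFA.bwd, WFA.matOf, M, mulVec_mulVec]
  have hf : M.f = f := by
    funext x
    change P [] ⬝ᵥ M.bwd x = f x
    rw [hbwd]
    exact (hfact [] x).symm
  exact ⟨M, hf, fun m hm => hrank m (hf ▸ hm), hfwd, hbwd⟩
end

section
/- Let f : Σ* → ℝ be a rational function of rank n and suppose its Hankel matrix admits a compact SVD H_f = U D Vᵀ, where U, V ∈ ℝ^{Σ*×n} have square-summable orthonormal columns (UᵀU = VᵀV = I_n) and D = diag(σ₁,…,σ_n) with σ₁ ≥ ⋯ ≥ σ_n > 0. Then there exists a minimal WFA A realizing f whose forward and backward matrices are P_A = U D^{1/2} and S_A = V D^{1/2}; i.e. αᵀA_p = (U D^{1/2})(p,:) and (A_s β)ᵀ = (V D^{1/2})(s,:) for all p, s ∈ Σ*. -/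
open scoped ENNReal
open scoped Kronecker
open Matrix

namespace WFA

variable {S : Type*} {n : ℕ}

lemma f_append_s4 (M : WFA S n) (p s : List S) : M.f (p ++ s) = M.fwd p ⬝ᵥ M.bwd s := by
  simp only [f, fwd, bwd, matOf, List.map_append, List.prod_append]
  rw [← Matrix.mulVec_mulVec, Matrix.dotProduct_mulVec]

/-- The conjugate of a WFA by a change of basis `Q` with inverse `R`. -/
def conj (M : WFA S n) (Q R : Matrix (Fin n) (Fin n) ℝ) : WFA S n where
  init := M.init ᵥ* Q
  final := R *ᵥ M.final
  trans := fun a => R * M.trans a * Q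

lemma matOf_conj (M : WFA S n) {Q R : Matrix (Fin n) (Fin n) ℝ} (h : Q * R = 1)
    (x : List S) : Q * (M.conj Q R).matOf x = M.matOf x * Q := by
  induction x with
  | nil => simp [matOf]
  | cons a x ih =>
    simp only [matOf, List.map_cons, List.prod_cons] at ih ⊢
    calc Q * ((M.conj Q R).trans a * (x.map (M.conj Q R).trans).prod)
        = Q * R * M.trans a * (Q * (x.map (M.conj Q R).trans).prod) := by
          simp only [conj, Matrix.mul_assoc]
      _ = _ := by rw [ih, h]; simp only [Matrix.mul_assoc, Matrix.one_mul]

lemma fwd_conj (M : WFA S n) {Q R : Matrix (Fin n) (Fin n) ℝ} (h : Q * R = 1)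
    (x : List S) : (M.conj Q R).fwd x = M.fwd x ᵥ* Q := by
  change (M.init ᵥ* Q) ᵥ* (M.conj Q R).matOf x = _
  rw [Matrix.vecMul_vecMul, matOf_conj M h, fwd, Matrix.vecMul_vecMul]

lemma bwd_conj (M : WFA S n) {Q R : Matrix (Fin n) (Fin n) ℝ} (h : Q * R = 1)
    (x : List S) : (M.conj Q R).bwd x = R *ᵥ M.bwd x := by
  have hRQ : R * Q = 1 := mul_eq_one_comm.mp h
  have key : (M.conj Q R).matOf x * R = R * M.matOf x := by
    calc (M.conj Q R).matOf x * R = R * (Q * (M.conj Q R).matOf x) * R := by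
          rw [← Matrix.mul_assoc R Q, hRQ, Matrix.one_mul]
      _ = R * M.matOf x * (Q * R) := by rw [matOf_conj M h]; simp only [Matrix.mul_assoc]
      _ = _ := by rw [h, Matrix.mul_one]
  change (M.conj Q R).matOf x *ᵥ (R *ᵥ M.final) = _
  rw [Matrix.mulVec_mulVec, key, bwd, Matrix.mulVec_mulVec]

/-- If the Hankel matrix of an `n`-dimensional WFA factors as `P Tᵀ` where the rows of both `P`
and `T` span `ℝⁿ`, then some conjugate of the WFA has forward matrix `P` and backward
matrix `T`. -/
lemma exists_fwd_bwd_eq (B : WFA S n) {P T : List S → Fin n → ℝ}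
    (hP : Submodule.span ℝ (Set.range P) = ⊤) (hT : Submodule.span ℝ (Set.range T) = ⊤)
    (hPT : ∀ p s, B.f (p ++ s) = P p ⬝ᵥ T s) :
    ∃ M : WFA S n, (∀ p, M.fwd p = P p) ∧ ∀ s, M.bwd s = T s := by
  have hd (i : Fin n) : ∃ d : List S →₀ ℝ, Finsupp.linearCombination ℝ P d = Pi.single i 1 := by
    rw [← Set.mem_range, ← LinearMap.coe_range, Finsupp.range_linearCombination, hP]; trivial
  have hc (i : Fin n) : ∃ c : List S →₀ ℝ, Finsupp.linearCombination ℝ T c = Pi.single i 1 := by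
    rw [← Set.mem_range, ← LinearMap.coe_range, Finsupp.range_linearCombination, hT]; trivial
  choose d hd using hd
  choose c hc using hc
  set Q : Matrix (Fin n) (Fin n) ℝ :=
    (Matrix.of fun j => Finsupp.linearCombination ℝ B.bwd (c j))ᵀ
  set R : Matrix (Fin n) (Fin n) ℝ := Matrix.of fun i => Finsupp.linearCombination ℝ B.fwd (d i)
  have hH (p s : List S) : B.fwd p ⬝ᵥ B.bwd s = P p ⬝ᵥ T s := by rw [← f_append_s4, hPT]
  have hQ (p : List S) : B.fwd p ᵥ* Q = P p := by
    ext j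
    calc (B.fwd p ᵥ* Q) j
        = dotProductBilin ℝ ℝ (B.fwd p) (Finsupp.linearCombination ℝ B.bwd (c j)) := rfl
      _ = dotProductBilin ℝ ℝ (P p) (Finsupp.linearCombination ℝ T (c j)) := by
          rw [Finsupp.apply_linearCombination, Finsupp.apply_linearCombination]
          congr 2
          ext s
          exact hH p s
      _ = P p j := by rw [hc]; simp
  have hR (s : List S) : R *ᵥ B.bwd s = T s := by
    ext i
    calc (R *ᵥ B.bwd s) i
        = (dotProductBilin ℝ ℝ).flip (B.bwd s) (Finsupp.linearCombination ℝ B.fwd (d i)) := rfl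
      _ = (dotProductBilin ℝ ℝ).flip (T s) (Finsupp.linearCombination ℝ P (d i)) := by
          rw [Finsupp.apply_linearCombination, Finsupp.apply_linearCombination]
          congr 2
          ext p
          exact hH p s
      _ = T s i := by rw [hd]; simp
  have hRQ : R * Q = 1 := by
    ext i j
    calc (R * Q) i j
        = (LinearMap.proj j ∘ₗ Matrix.vecMulLinear Q)
            (Finsupp.linearCombination ℝ B.fwd (d i)) := rfl
      _ = (LinearMap.proj j : (Fin n → ℝ) →ₗ[ℝ] ℝ) (Finsupp.linearCombination ℝ P (d i)) := by
          rw [Finsupp.apply_linearCombination, Finsupp.apply_linearCombination]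
          congr 2
          ext p
          exact congrFun (hQ p) j
      _ = (1 : Matrix (Fin n) (Fin n) ℝ) i j := by
          rw [hd]; simp [Matrix.one_apply, Pi.single_apply, eq_comm]
  have hQR : Q * R = 1 := mul_eq_one_comm.mp hRQ
  exact ⟨B.conj Q R, fun p => by rw [fwd_conj B hQR, hQ], fun s => by rw [bwd_conj B hQR, hR]⟩

end WFA

/-- The rows of a matrix with finitely many orthonormal columns span, also after rescaling the
columns by nonzero factors. -/
lemma span_range_mul_eq_top_of_orthonormal {ι : Type*} {n : ℕ} {U : ι → Fin n → ℝ} {r : Fin n → ℝ}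
    (hsum : ∀ i j, Summable fun x => U x i * U x j)
    (horth : ∀ i j, (∑' x, U x i * U x j) = if i = j then (1 : ℝ) else 0) (hr : ∀ i, r i ≠ 0) :
    Submodule.span ℝ (Set.range fun x i => U x i * r i) = ⊤ := by
  by_contra hne
  obtain ⟨φ, hφ, hker⟩ := Submodule.exists_le_ker_of_lt_top _ (lt_top_iff_ne_top.mpr hne)
  have hsingle (v : Fin n → ℝ) : φ v = ∑ i, v i * φ (Pi.single i 1) := by
    conv_lhs => rw [pi_eq_sum_univ' v]
    simp
  have hzero (x : ι) : ∑ i, U x i * (r i * φ (Pi.single i 1)) = 0 := by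
    have h := hker (Submodule.subset_span (Set.mem_range_self x))
    rw [LinearMap.mem_ker, hsingle] at h
    simpa only [mul_assoc] using h
  refine hφ (LinearMap.ext fun v => ?_)
  rw [hsingle]
  refine Finset.sum_eq_zero fun j _ => ?_
  have hj : ∑' x, ∑ i, U x i * U x j * (r i * φ (Pi.single i 1)) = 0 := by
    have h (x : ι) : ∑ i, U x i * U x j * (r i * φ (Pi.single i 1)) = 0 := by
      simp only [mul_right_comm _ (U x j), ← Finset.sum_mul, hzero, zero_mul]
    simp only [h, tsum_zero]
  rw [Summable.tsum_finsetSum fun i _ => (hsum i j).mul_right _] at hj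
  simp_rw [tsum_mul_right, horth] at hj
  have : φ (Pi.single j 1) = 0 := by simpa [hr j] using hj
  rw [this, mul_zero]

/-- if the Hankel matrix of a rational function `f` of rank `n` admits a compact
SVD `H_f = U D Vᵀ`, then there is a minimal WFA for `f` whose forward and backward matrices
are `U D^{1/2}` and `V D^{1/2}`. -/
theorem sva_exists_of_compact_svd {S : Type*} [Fintype S] {n : ℕ}
    (f : List S → ℝ)
    (hrat : ∃ B : WFA S n, B.f = f)
    (hrank : ∀ m : ℕ, (∃ B : WFA S m, B.f = f) → n ≤ m)
    (U V : List S → Fin n → ℝ) (σ : Fin n → ℝ)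
    (hUsum : ∀ i j, Summable fun x : List S => U x i * U x j)
    (hVsum : ∀ i j, Summable fun x : List S => V x i * V x j)
    (hUorth : ∀ i j, (∑' x : List S, U x i * U x j) = if i = j then (1 : ℝ) else 0)
    (hVorth : ∀ i j, (∑' x : List S, V x i * V x j) = if i = j then (1 : ℝ) else 0)
    (hσpos : ∀ i, 0 < σ i) (hσmono : ∀ i j : Fin n, i ≤ j → σ j ≤ σ i)
    (hsvd : ∀ p s : List S, f (p ++ s) = ∑ i : Fin n, U p i * σ i * V s i) :
    ∃ M : WFA S n, M.f = f ∧ M.Min ∧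
      (∀ p i, M.fwd p i = U p i * Real.sqrt (σ i)) ∧
      (∀ s i, M.bwd s i = V s i * Real.sqrt (σ i)) := by
  obtain ⟨B, hB⟩ := hrat
  have hr (i : Fin n) : √(σ i) ≠ 0 := (Real.sqrt_pos.mpr (hσpos i)).ne'
  have hPT (p s : List S) :
      f (p ++ s) = (fun i => U p i * √(σ i)) ⬝ᵥ (fun i => V s i * √(σ i)) := by
    rw [hsvd]
    refine Finset.sum_congr rfl fun i _ => ?_
    linear_combination -(U p i * V s i) * Real.mul_self_sqrt (hσpos i).le
  obtain ⟨M, hfwd, hbwd⟩ := B.exists_fwd_bwd_eq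
    (span_range_mul_eq_top_of_orthonormal hUsum hUorth hr)
    (span_range_mul_eq_top_of_orthonormal hVsum hVorth hr) (fun p s => by rw [hB, hPT])
  have hM : M.f = f := by
    ext x
    simpa [hfwd, hbwd, ← hPT] using M.f_append_s4 x []
  exact ⟨M, hM, by rwa [WFA.Min, hM], fun p i => congrFun (hfwd p) i,
    fun s i => congrFun (hbwd s) i⟩
end

section
/- For any finite collection of square real matrices A₁, …, A_m ∈ ℝ^{n×n}, the induced ∞-norm of the Kronecker sum satisfies ‖Σ_{k=1}^m A_k ⊗ A_k‖_∞ ≤ ‖[A₁ … A_m]‖_∞ · ‖[A₁ᵀ … A_mᵀ]‖₁, where [A₁ … A_m] is the n × mn block-row matrix, ‖[A₁ᵀ … A_mᵀ]‖₁ equals the ∞-norm of the mn × n block-column matrix stacking A₁, …, A_m. -/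
open scoped ENNReal
open scoped Kronecker
open Matrix

/-- Every absolute row sum is bounded by the induced `∞`-norm. -/
theorem rowSum_le_normInfM {d e : Type*} [Fintype d] [Fintype e] (M : Matrix d e ℝ) (i : d) :
    ∑ j, |M i j| ≤ normInfM M :=
  le_ciSup (f := fun i => ∑ j, |M i j|) (Set.finite_range _).bddAbove i

/-- Every absolute column sum is bounded by the induced `1`-norm. -/
theorem colSum_le_normOneM {d e : Type*} [Fintype d] [Fintype e] (M : Matrix d e ℝ) (j : e) :
    ∑ i, |M i j| ≤ normOneM M :=
  le_ciSup (f := fun j => ∑ i, |M i j|) (Set.finite_range _).bddAbove j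

theorem normInfM_nonneg {d e : Type*} [Fintype d] [Fintype e] (M : Matrix d e ℝ) :
    0 ≤ normInfM M :=
  Real.iSup_nonneg fun _ => Finset.sum_nonneg fun _ _ => abs_nonneg _

theorem normOneM_nonneg {d e : Type*} [Fintype d] [Fintype e] (M : Matrix d e ℝ) :
    0 ≤ normOneM M :=
  Real.iSup_nonneg fun _ => Finset.sum_nonneg fun _ _ => abs_nonneg _

/-- An absolute row sum of `∑ k, A k ⊗ A k` is bounded by the sum over `k` of the products of the
corresponding absolute row sums of `A k`. -/
theorem rowSum_kronecker_sum_le {ι d e : Type*} [Fintype ι] [Fintype e]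
    (A : ι → Matrix d e ℝ) (i i' : d) :
    ∑ q : e × e, |(∑ k, A k ⊗ₖ A k) (i, i') q| ≤
      ∑ k, (∑ j, |A k i j|) * ∑ j, |A k i' j| := by
  calc ∑ q : e × e, |(∑ k, A k ⊗ₖ A k) (i, i') q|
      ≤ ∑ q : e × e, ∑ k, |A k i q.1| * |A k i' q.2| := by
        refine Finset.sum_le_sum fun q _ => ?_
        rw [Matrix.sum_apply]
        refine (Finset.abs_sum_le_sum_abs _ _).trans_eq ?_
        simp [Matrix.kroneckerMap_apply, abs_mul]
    _ = ∑ k, (∑ j, |A k i j|) * ∑ j, |A k i' j| := by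
        rw [Finset.sum_comm]
        simp_rw [Fintype.sum_prod_type, Finset.sum_mul_sum]

/-- `‖∑_k A_k ⊗ A_k‖_∞ ≤ ‖[A₁ … A_m]‖_∞ · ‖[A₁ᵀ … A_mᵀ]‖₁`. -/
theorem normInf_kronecker_sum_le {n m : ℕ} (A : Fin m → Matrix (Fin n) (Fin n) ℝ) :
    normInfM (∑ k : Fin m, A k ⊗ₖ A k) ≤
      normInfM (Matrix.of fun (i : Fin n) (kj : Fin m × Fin n) => A kj.1 i kj.2) *
      normOneM (Matrix.of fun (i : Fin n) (kj : Fin m × Fin n) => (A kj.1)ᵀ i kj.2) := by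
  set R := Matrix.of fun (i : Fin n) (kj : Fin m × Fin n) => A kj.1 i kj.2
  set C := Matrix.of fun (i : Fin n) (kj : Fin m × Fin n) => (A kj.1)ᵀ i kj.2
  refine Real.iSup_le ?_ (mul_nonneg (normInfM_nonneg R) (normOneM_nonneg C))
  rintro ⟨i, i'⟩
  calc ∑ q, |(∑ k : Fin m, A k ⊗ₖ A k) (i, i') q|
      ≤ ∑ k, (∑ j, |A k i j|) * ∑ j, |A k i' j| := rowSum_kronecker_sum_le A i i'
    _ ≤ ∑ k, (∑ j, |A k i j|) * normOneM C :=
        Finset.sum_le_sum fun k _ => mul_le_mul_of_nonneg_left (colSum_le_normOneM C (k, i'))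
          (Finset.sum_nonneg fun _ _ => abs_nonneg _)
    _ = (∑ kj, |R i kj|) * normOneM C := by
        rw [← Finset.sum_mul, Fintype.sum_prod_type]
        rfl
    _ ≤ normInfM R * normOneM C :=
        mul_le_mul_of_nonneg_right (rowSum_le_normInfM R i) (normOneM_nonneg C)
end

section
/- Let A = ⟨α, β, {A_a}⟩ be a WFA of dimension n over a finite alphabet Σ whose reachability Gramian G_p and observability Gramian G_s are well-defined. Then X = G_p solves the fixed-point equation X = ααᵀ + Σ_{a∈Σ} A_aᵀ X A_a, and Y = G_s solves the fixed-point equation Y = ββᵀ + Σ_{a∈Σ} A_a Y A_aᵀ. -/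
open scoped ENNReal
open scoped Kronecker
open Matrix

/-- The empty list, or a head together with a tail. -/
def listEquivSum (S : Type*) : Unit ⊕ S × List S ≃ List S where
  toFun := Sum.elim (fun _ => []) fun p => p.1 :: p.2
  invFun
    | [] => Sum.inl ()
    | a :: x => Sum.inr (a, x)
  left_inv := by rintro (_ | _) <;> rfl
  right_inv := by rintro (_ | _) <;> rfl

theorem tsum_list {S E : Type*} [Fintype S] [NormedAddCommGroup E] [CompleteSpace E]
    {f : List S → E} (hf : Summable f) :
    ∑' x, f x = f [] + ∑ a, ∑' x, f (a :: x) := by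
  have hr : Summable fun p : S × List S => f (p.1 :: p.2) :=
    hf.comp_injective ((listEquivSum S).injective.comp Sum.inr_injective)
  have hl : HasSum (fun _ : Unit => f []) (f []) := hasSum_unique _
  have hsum : HasSum (f ∘ listEquivSum S) (f [] + ∑' p : S × List S, f (p.1 :: p.2)) :=
    hl.sum hr.hasSum
  rw [((listEquivSum S).hasSum_iff.mp hsum).tsum_eq, hr.tsum_prod, tsum_fintype]

theorem gramian_eq_of_cons {S ι : Type*} [Fintype S] [Fintype ι] {w : List S → ι → ℝ}
    {B : S → Matrix ι ι ℝ} (hw : ∀ a x, w (a :: x) = B a *ᵥ w x)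
    (hs : ∀ i j, Summable fun x => w x i * w x j) :
    (Matrix.of fun i j => ∑' x, w x i * w x j) = Matrix.vecMulVec (w []) (w []) +
      ∑ a, B a * (Matrix.of fun i j => ∑' x, w x i * w x j) * (B a)ᵀ := by
  have hG : HasSum (fun x => Matrix.vecMulVec (w x) (w x))
      (Matrix.of fun i j => ∑' x, w x i * w x j) :=
    Pi.hasSum.mpr fun i => Pi.hasSum.mpr fun j => (hs i j).hasSum
  have hB (a : S) : HasSum (fun x => Matrix.vecMulVec (w (a :: x)) (w (a :: x)))
      (B a * (Matrix.of fun i j => ∑' x, w x i * w x j) * (B a)ᵀ) := by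
    simpa only [hw, Matrix.mul_vecMulVec, Matrix.vecMulVec_mul, Matrix.vecMul_transpose] using
      (hG.mul_left (B a)).mul_right (B a)ᵀ
  ext i j
  have hij := tsum_list (hs i j)
  simp only [Matrix.of_apply, Matrix.add_apply, Matrix.sum_apply, Matrix.vecMulVec_apply]
  rw [hij]
  congr 1
  exact Finset.sum_congr rfl fun a _ => (Pi.hasSum.mp (Pi.hasSum.mp (hB a) i) j).tsum_eq

theorem WFA.fwd_reverse_cons {S : Type*} {n : ℕ} (M : WFA S n) (a : S) (x : List S) :
    M.fwd (a :: x).reverse = (M.trans a)ᵀ *ᵥ M.fwd x.reverse := by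
  simp [WFA.fwd, WFA.matOf, Matrix.mulVec_transpose, ← Matrix.vecMul_vecMul]

theorem WFA.bwd_cons {S : Type*} {n : ℕ} (M : WFA S n) (a : S) (x : List S) :
    M.bwd (a :: x) = M.trans a *ᵥ M.bwd x := by
  simp [WFA.bwd, WFA.matOf]

/-- the Gramians satisfy the fixed-point equations
`G_p = ααᵀ + ∑_a A_aᵀ G_p A_a` and `G_s = ββᵀ + ∑_a A_a G_s A_aᵀ`. -/
theorem gramian_fixed_point_equations {S : Type*} [Fintype S] {n : ℕ} (M : WFA S n)
    (hGp : M.GpDefined) (hGs : M.GsDefined) :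
    M.Gp = Matrix.vecMulVec M.init M.init + ∑ a : S, (M.trans a)ᵀ * M.Gp * M.trans a ∧
    M.Gs = Matrix.vecMulVec M.final M.final + ∑ a : S, M.trans a * M.Gs * (M.trans a)ᵀ := by
  have hrev : Function.Involutive (List.reverse : List S → List S) := List.reverse_reverse
  have hGp_rev : M.Gp = Matrix.of fun i j =>
      ∑' x : List S, M.fwd x.reverse i * M.fwd x.reverse j := by
    ext i j
    exact (hrev.toPerm.tsum_eq fun x => M.fwd x i * M.fwd x j).symm
  constructor
  · have h := gramian_eq_of_cons (w := fun x => M.fwd x.reverse) M.fwd_reverse_cons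
      fun i j => (hGp i j).comp_injective hrev.injective
    rw [← hGp_rev] at h
    simpa [WFA.fwd, WFA.matOf] using h
  · simpa [WFA.Gs, WFA.bwd, WFA.matOf] using gramian_eq_of_cons M.bwd_cons hGs
end

section
/- Let A = ⟨α, β, {A_a}⟩ be a WFA of dimension n whose Gramians G_p and G_s are well-defined. Then G_p is the least (in the Loewner order) positive semi-definite solution of the linear matrix inequality X ≥ ααᵀ + Σ_{a∈Σ} A_aᵀ X A_a, and G_s is the least positive semi-definite solution of Y ≥ ββᵀ + Σ_{a∈Σ} A_a Y A_aᵀ. That is, G_p (resp. G_s) satisfies the inequality, and any positive semi-definite X (resp. Y) satisfying it has X − G_p ≥ 0 (resp. Y − G_s ≥ 0). -/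
open scoped ENNReal
open scoped Kronecker
open Matrix

open Filter Topology in
/-- A limit of matrices dominated by `Y` in the Loewner order is dominated by `Y`. -/
theorem posSemidef_sub_of_tendsto {n : ℕ} {T : ℕ → Matrix (Fin n) (Fin n) ℝ}
    {Y G : Matrix (Fin n) (Fin n) ℝ} (hT : Tendsto T atTop (𝓝 G))
    (h : ∀ k, (Y - T k).PosSemidef) : (Y - G).PosSemidef := by
  have hlim : Tendsto (fun k => Y - T k) atTop (𝓝 (Y - G)) := hT.const_sub Y
  refine Matrix.PosSemidef.of_dotProduct_mulVec_nonneg ?_ fun u => ?_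
  · have hH : Tendsto (fun k => (Y - T k)ᴴ) atTop (𝓝 (Y - G)ᴴ) :=
      (continuous_id.matrix_conjTranspose.tendsto _).comp hlim
    exact tendsto_nhds_unique hH (hlim.congr fun k => (h k).isHermitian.eq.symm)
  · have hc : Continuous fun Z : Matrix (Fin n) (Fin n) ℝ => star u ⬝ᵥ Z *ᵥ u :=
      continuous_const.dotProduct (continuous_id.matrix_mulVec continuous_const)
    exact ge_of_tendsto ((hc.tendsto _).comp hlim)
      (Eventually.of_forall fun k => (h k).dotProduct_mulVec_nonneg u)

/-- The lists over `S` of length less than `k`. -/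
def listsOfLengthLT (S : Type*) [Fintype S] : ℕ → Finset (List S)
  | 0 => ∅
  | k + 1 => Finset.cons []
      ((Finset.univ ×ˢ listsOfLengthLT S k).map
        ⟨fun p : S × List S => p.1 :: p.2, fun p q h => by
          simpa [Prod.ext_iff] using h⟩) (by simp)

theorem mem_listsOfLengthLT {S : Type*} [Fintype S] {k : ℕ} {x : List S} :
    x ∈ listsOfLengthLT S k ↔ x.length < k := by
  induction k generalizing x with
  | zero => simp [listsOfLengthLT]
  | succ k ih => cases x <;> simp [listsOfLengthLT, ih, DFunLike.coe]

theorem sum_listsOfLengthLT_succ {S E : Type*} [Fintype S] [AddCommMonoid E]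
    (g : List S → E) (k : ℕ) :
    ∑ x ∈ listsOfLengthLT S (k + 1), g x =
      g [] + ∑ a : S, ∑ x ∈ listsOfLengthLT S k, g (a :: x) := by
  simp [listsOfLengthLT, Finset.sum_product, DFunLike.coe]

open Filter in
theorem tendsto_listsOfLengthLT (S : Type*) [Fintype S] :
    Tendsto (listsOfLengthLT S) atTop atTop :=
  tendsto_atTop_finset_of_monotone
    (fun _ _ hkl _ hx => mem_listsOfLengthLT.2 ((mem_listsOfLengthLT.1 hx).trans_le hkl))
    fun x => ⟨x.length + 1, mem_listsOfLengthLT.2 x.length.lt_succ_self⟩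

open Filter Topology in
/-- The Gramian of a family of vectors generated from `b` by the matrices `B a` is the least
positive semi-definite solution of the associated linear matrix inequality. -/
theorem gramian_least_psd_solution {S : Type*} [Fintype S] {n : ℕ}
    (B : S → Matrix (Fin n) (Fin n) ℝ) (b : Fin n → ℝ) (v : List S → Fin n → ℝ)
    (hnil : v [] = b) (hcons : ∀ a x, v (a :: x) = B a *ᵥ v x)
    {G : Matrix (Fin n) (Fin n) ℝ} (hG : HasSum (fun x => vecMulVec (v x) (v x)) G) :
    (G - (vecMulVec b b + ∑ a : S, B a * G * (B a)ᵀ)).PosSemidef ∧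
    ∀ Y : Matrix (Fin n) (Fin n) ℝ, Y.PosSemidef →
      (Y - (vecMulVec b b + ∑ a : S, B a * Y * (B a)ᵀ)).PosSemidef →
      (Y - G).PosSemidef := by
  set T : ℕ → Matrix (Fin n) (Fin n) ℝ :=
    fun k => ∑ x ∈ listsOfLengthLT S k, vecMulVec (v x) (v x) with hTdef
  have hT : Tendsto T atTop (𝓝 G) := hG.comp (tendsto_listsOfLengthLT S)
  have hsucc (k : ℕ) : T (k + 1) = vecMulVec b b + ∑ a : S, B a * T k * (B a)ᵀ := by
    simp only [hTdef, sum_listsOfLengthLT_succ, hnil, hcons, Finset.mul_sum, Finset.sum_mul,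
      mul_vecMulVec, vecMulVec_mul, vecMul_transpose]
  constructor
  · have hc : Continuous fun Z : Matrix (Fin n) (Fin n) ℝ =>
        vecMulVec b b + ∑ a : S, B a * Z * (B a)ᵀ := by fun_prop
    have hfix : G = vecMulVec b b + ∑ a : S, B a * G * (B a)ᵀ :=
      tendsto_nhds_unique (hT.comp (tendsto_add_atTop_nat 1))
        (((hc.tendsto G).comp hT).congr fun k => (hsucc k).symm)
    rw [← hfix, sub_self]
    exact Matrix.PosSemidef.zero
  · intro Y hY hYle
    refine posSemidef_sub_of_tendsto hT fun k => ?_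
    induction k with
    | zero => simpa [hTdef, listsOfLengthLT] using hY
    | succ k ih =>
      have hstep : (∑ a : S, B a * (Y - T k) * (B a)ᵀ).PosSemidef :=
        Matrix.posSemidef_sum _ fun a _ => by
          simpa using ih.mul_mul_conjTranspose_same (B a)
      convert hYle.add hstep using 1
      simp only [hsucc, Matrix.mul_sub, Matrix.sub_mul, Finset.sum_sub_distrib]
      abel

/-- `G_p` (resp. `G_s`) is the least positive semi-definite solution of the
linear matrix inequality `X ≥ ααᵀ + ∑_a A_aᵀ X A_a` (resp. `Y ≥ ββᵀ + ∑_a A_a Y A_aᵀ`). -/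
theorem gramians_least_psd_solutions {S : Type*} [Fintype S] {n : ℕ} (M : WFA S n)
    (hGp : M.GpDefined) (hGs : M.GsDefined) :
    (M.Gp - (Matrix.vecMulVec M.init M.init +
      ∑ a : S, (M.trans a)ᵀ * M.Gp * M.trans a)).PosSemidef ∧
    (∀ X : Matrix (Fin n) (Fin n) ℝ, X.PosSemidef →
      (X - (Matrix.vecMulVec M.init M.init +
        ∑ a : S, (M.trans a)ᵀ * X * M.trans a)).PosSemidef →
      (X - M.Gp).PosSemidef) ∧
    (M.Gs - (Matrix.vecMulVec M.final M.final +
      ∑ a : S, M.trans a * M.Gs * (M.trans a)ᵀ)).PosSemidef ∧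
    (∀ Y : Matrix (Fin n) (Fin n) ℝ, Y.PosSemidef →
      (Y - (Matrix.vecMulVec M.final M.final +
        ∑ a : S, M.trans a * Y * (M.trans a)ᵀ)).PosSemidef →
      (Y - M.Gs).PosSemidef) := by
  have hp : HasSum (fun x : List S => vecMulVec (M.fwd x.reverse) (M.fwd x.reverse)) M.Gp :=
    (Equiv.hasSum_iff (List.reverse_involutive.toPerm List.reverse)
      (f := fun x => vecMulVec (M.fwd x) (M.fwd x))).2
      (Pi.hasSum.2 fun i => Pi.hasSum.2 fun j => (hGp i j).hasSum)
  have hs : HasSum (fun x : List S => vecMulVec (M.bwd x) (M.bwd x)) M.Gs :=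
    Pi.hasSum.2 fun i => Pi.hasSum.2 fun j => (hGs i j).hasSum
  have hfwd := gramian_least_psd_solution (fun a => (M.trans a)ᵀ) M.init _
    (by simp [WFA.fwd, WFA.matOf])
    (fun a x => by simp [WFA.fwd, WFA.matOf, mulVec_transpose, vecMul_vecMul]) hp
  have hbwd := gramian_least_psd_solution M.trans M.final _
    (by simp [WFA.bwd, WFA.matOf])
    (fun a x => by simp [WFA.bwd, WFA.matOf]) hs
  simp only [transpose_transpose] at hfwd
  exact ⟨hfwd.1, hfwd.2, hbwd.1, hbwd.2⟩
end
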